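/- Let L ∈ T. Then the center of the core satisfies Z(L_c) ⊆ ⊕_{δ ∈ R^0} L_δ, i.e., the center of the core is contained in the sum of isotropic root spaces. -/

import Mathlib

open scoped Classical

namespace Gen

variable (F L : Type*) [Field F] [CharZero F] [LieRing L] [LieAlgebra F L]

/-- The weight space of a linear functional `α` on a subalgebra `H`. -/
def wt (H : LieSubalgebra F L) (α : Module.Dual F H) : Submodule F L where
  carrier := {x : L | ∀ h : H, ⁅(h : L), x⁆ = α h • x}
  add_mem' := by
    intro a b ha hb h
    rw [lie_add, ha h, hb h, smul_add]
  zero_mem' := by intro h; simp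
  smul_mem' := by
    intro c x hx h
    rw [lie_smul, hx h, smul_comm]

/-- Data for axioms (T1) and (T2): a non-degenerate symmetric invariant bilinear form,
a finite dimensional split toral subalgebra `H` on which the form is non-degenerate,
together with the representatives `t_α ∈ H` of linear functionals on `H`. -/
structure TData where
  B : L →ₗ[F] L →ₗ[F] F
  bsymm : ∀ x y, B x y = B y x
  binv : ∀ x y z, B ⁅x, y⁆ z = B x ⁅y, z⁆
  bnondeg : ∀ x, (∀ y, B x y = 0) → x = 0
  H : LieSubalgebra F L
  hne : H ≠ ⊥
  hfin : FiniteDimensional F H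
  hnondeg : ∀ h : H, (∀ h' : H, B h h' = 0) → h = 0
  decomp : DirectSum.IsInternal (wt F L H)
  t : Module.Dual F H → H
  tspec : ∀ (α : Module.Dual F H) (h : H), B (t α) h = α h

variable {F L}

namespace TData

variable (T : TData F L)

/-- The form transferred to the dual of `H`: `(α, β) = (t_α, t_β)`. -/
def pr (α β : Module.Dual F T.H) : F := T.B (T.t α) (T.t β)

/-- The root system `R = {α : L_α ≠ 0}`. -/
def R : Set (Module.Dual F T.H) := {α | wt F L T.H α ≠ ⊥}

/-- Non-isotropic roots. -/
def Rx : Set (Module.Dual F T.H) := {α | α ∈ T.R ∧ T.pr α α ≠ 0}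

/-- Isotropic roots. -/
def R0 : Set (Module.Dual F T.H) := {α | α ∈ T.R ∧ T.pr α α = 0}

/-- The core: the subalgebra generated by the non-isotropic root spaces. -/
def core : LieSubalgebra F L :=
  LieSubalgebra.lieSpan F L (⋃ α ∈ T.Rx, (wt F L T.H α : Set L))

end TData

variable (F L)

/-- A Lie algebra in the class 𝒯: axioms (T1)–(T6). -/
structure TAlg extends TData F L where
  t3a : ∀ δ ∈ toTData.R0, ∃ x ∈ wt F L toTData.H δ, ∃ y ∈ wt F L toTData.H (-δ),
          ⁅x, y⁆ = (toTData.t δ : L)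
  t3b : ∀ α ∈ toTData.Rx, ∀ x ∈ wt F L toTData.H α, x ≠ 0 →
          ∃ y ∈ wt F L toTData.H (-α), ⁅x, y⁆ = (toTData.t α : L)
  t4 : ∀ α ∈ toTData.Rx, ∀ x ∈ wt F L toTData.H α, ∀ y : L,
          ∃ n : ℕ, ((LieAlgebra.ad F L x) ^ n) y = 0
  t5a : ∀ S1 S2 : Set (Module.Dual F toTData.H), S1.Nonempty → S2.Nonempty →
          S1 ∪ S2 = toTData.Rx → Disjoint S1 S2 →
          ∃ a ∈ S1, ∃ b ∈ S2, toTData.pr a b ≠ 0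
  t5b : ∀ δ ∈ toTData.R0, ∃ α ∈ toTData.Rx, α + δ ∈ toTData.R
  t6free : Module.Free ℤ (AddSubgroup.closure toTData.R0)
  t6fin : Module.Finite ℤ (AddSubgroup.closure toTData.R0)

end Gen

/-- For `L ∈ 𝒯`, the center of the core lies in the sum of the isotropic
root spaces: `Z(L_c) ⊆ ⨆_{δ ∈ R⁰} L_δ`. -/
theorem center_core_subset_isotropic
    (F L : Type*) [Field F] [CharZero F] [LieRing L] [LieAlgebra F L]
    (T : Gen.TAlg F L) :
    ∀ z ∈ T.toTData.core, (∀ x ∈ T.toTData.core, ⁅z, x⁆ = 0) →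
      z ∈ (⨆ δ ∈ T.toTData.R0, Gen.wt F L T.toTData.H δ : Submodule F L) := by
  intro z _ hz
  have hind := T.decomp.submodule_iSupIndep
  have htop := T.decomp.submodule_iSup_eq_top
  obtain ⟨f, hf, hsum⟩ := (Submodule.mem_iSup_iff_exists_finsupp (Gen.wt F L T.H) z).1
    (htop ▸ Submodule.mem_top)
  have key : ∀ α, ∀ β ∈ T.toTData.Rx, ∀ x ∈ Gen.wt F L T.H β, ⁅f α, x⁆ = 0 := by
    intro α β hβ x hx
    by_cases hα : α ∈ f.support
    · have hcomp : iSupIndep (fun γ => Gen.wt F L T.H (γ + β)) :=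
        hind.comp (f := fun γ => γ + β) (add_left_injective β)
      refine (iSupIndep_iff_finsetSum_eq_zero_imp_eq_zero _).1 hcomp f.support
        (fun γ => ⁅f γ, x⁆) ?_ ?_ α hα
      · intro γ _ h
        have h1 := hf γ h
        have h2 := hx h
        rw [leibniz_lie, h1, h2, smul_lie, lie_smul, ← add_smul]
        rfl
      · have hxc : x ∈ T.toTData.core :=
          LieSubalgebra.subset_lieSpan (Set.mem_biUnion hβ hx)
        have := hz x hxc
        rw [← hsum, Finsupp.sum, _root_.sum_lie] at this
        exact this
    · rw [Finsupp.notMem_support_iff.1 hα, zero_lie]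
  rw [← hsum]
  refine Submodule.sum_mem _ ?_
  intro α hα
  have hne : f α ≠ 0 := Finsupp.mem_support_iff.1 hα
  have hR : α ∈ T.toTData.R := fun h => hne (by
    have := hf α
    rw [h] at this
    simpa using this)
  by_cases hp : T.toTData.pr α α = 0
  · exact Submodule.mem_iSup_of_mem α (Submodule.mem_iSup_of_mem ⟨hR, hp⟩ (hf α))
  · exfalso
    obtain ⟨y, hy, hxy⟩ := T.t3b α ⟨hR, hp⟩ (f α) (hf α) hne
    have ht : (T.t α : L) ≠ 0 := by
      intro h
      apply hp
      simp [Gen.TData.pr, h]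
    have hy0 : y ≠ 0 := by
      rintro rfl
      exact ht (by rw [← hxy, lie_zero])
    have hneg : -α ∈ T.toTData.Rx := by
      refine ⟨fun h => hy0 ?_, ?_⟩
      · rw [h] at hy
        simpa using hy
      · have e : T.toTData.pr (-α) (-α) = T.toTData.pr α α := by
          unfold Gen.TData.pr
          rw [T.tspec, LinearMap.neg_apply, ← T.tspec α, T.bsymm, T.tspec,
            LinearMap.neg_apply, neg_neg, T.tspec]
        rw [e]
        exact hp
    exact ht (by rw [← hxy, key α (-α) hneg y hy])
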